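/- Fix positive integers m and n and reals a, c. Let F = {F_t}_{t=0}^n be a filtration and (ε_t, Z_t)_{t=1,…,n} a sequence of {0,1} × ℝ-valued random variables such that for each t ∈ {1,…,n}, ε_t is F_{t−1}-measurable, Z_t is F_t-measurable, E[Z_t | F_{t−1}] = 0, and Z_t ∈ [a, a+c] almost surely. Assume Σ_{s=1}^n ε_s ≤ m with probability one. Then for any λ > 0, P( Σ_{t=1}^n ε_t·Z_t ≥ λ ) ≤ exp( −2λ² / (c²·m) ). -/

import Mathlib

open MeasureTheory ProbabilityTheory Finset

noncomputable section

/-- **Hoeffding's lemma**, conditional form: weighting by a nonnegative integrable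
`m`-measurable function `W` does not affect the bound on the exponential moment. -/
lemma integral_mul_exp_le_of_condExp_eq_zero {Ω : Type*} {m mΩ : MeasurableSpace Ω}
    {P : Measure Ω} [IsProbabilityMeasure P] (hm : m ≤ mΩ) {a c s : ℝ} (hc : 0 ≤ c)
    {W Z : Ω → ℝ} (hW : StronglyMeasurable[m] W) (hW0 : ∀ ω, 0 ≤ W ω) (hWi : Integrable W P)
    (hZ : AEMeasurable Z P) (hZcond : P[Z|m] =ᵐ[P] 0)
    (hZbdd : ∀ᵐ ω ∂P, Z ω ∈ Set.Icc a (a + c)) :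
    ∫ ω, W ω * Real.exp (s * Z ω) ∂P ≤ Real.exp (c ^ 2 * s ^ 2 / 8) * ∫ ω, W ω ∂P := by
  set I := ∫ ω, W ω ∂P with hI
  have hI0 : 0 ≤ I := integral_nonneg hW0
  have hWm : Measurable W := (hW.mono hm).measurable
  rcases hI0.eq_or_lt with hI0 | hI0
  · have h0 : W =ᵐ[P] 0 := (integral_eq_zero_iff_of_nonneg hW0 hWi).1 hI0.symm
    rw [← hI0, mul_zero]
    refine (integral_eq_zero_of_ae ?_).le
    filter_upwards [h0] with ω h
    simp [h]
  have hZi : Integrable Z P := Integrable.of_mem_Icc a (a + c) hZ hZbdd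
  have hWZi : Integrable (W * Z) P := by
    refine hWi.mul_bdd (c := max |a| |a + c|) hZ.aestronglyMeasurable ?_
    filter_upwards [hZbdd] with ω h
    exact abs_le_max_abs_abs h.1 h.2
  have hWZ : ∫ ω, W ω * Z ω ∂P = 0 := by
    change ∫ ω, (W * Z) ω ∂P = 0
    rw [← integral_condExp hm]
    refine integral_eq_zero_of_ae ?_
    filter_upwards [condExp_mul_of_stronglyMeasurable_left hW hWZi hZi, hZcond] with ω h1 h2
    simp [h1, h2]
  set Q : Measure Ω := P.withDensity fun ω ↦ ENNReal.ofReal (W ω / I) with hQ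
  have hdens : Measurable fun ω ↦ ENNReal.ofReal (W ω / I) := (hWm.div_const I).ennreal_ofReal
  have hQint (f : Ω → ℝ) : ∫ ω, f ω ∂Q = (∫ ω, W ω * f ω ∂P) / I := by
    rw [hQ, integral_withDensity_eq_integral_toReal_smul hdens (by simp), ← integral_div]
    refine integral_congr_ae (.of_forall fun ω ↦ ?_)
    simp only [ENNReal.toReal_ofReal (div_nonneg (hW0 ω) hI0.le), smul_eq_mul]
    ring
  have hQprob : IsProbabilityMeasure Q := by
    refine ⟨?_⟩
    rw [hQ, withDensity_apply _ .univ, Measure.restrict_univ,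
      ← ofReal_integral_eq_lintegral_ofReal (hWi.div_const I)
        (.of_forall fun ω ↦ div_nonneg (hW0 ω) hI0.le), integral_div, ← hI, div_self hI0.ne',
      ENNReal.ofReal_one]
  have hQP : Q ≪ P := withDensity_absolutelyContinuous _ _
  have hsub := hasSubgaussianMGF_of_mem_Icc_of_integral_eq_zero (hZ.mono_ac hQP)
    (hQP.ae_le hZbdd) (by rw [hQint, hWZ, zero_div])
  have hmgf := hsub.mgf_le s
  rw [mgf, hQint, div_le_iff₀ hI0] at hmgf
  refine hmgf.trans_eq ?_
  congr 2
  push_cast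
  rw [add_sub_cancel_left, Real.norm_of_nonneg hc]
  ring

/-- The exponential process associated with optionally skipped martingale differences is
integrable with integral at most one. -/
lemma integral_exp_sum_skipped_le_one {Ω : Type*} {mΩ : MeasurableSpace Ω}
    {P : Measure Ω} [IsProbabilityMeasure P] (n : ℕ) {a c : ℝ} (hc : 0 ≤ c) (s : ℝ)
    (F : Filtration ℕ mΩ) (ε Z : ℕ → Ω → ℝ)
    (hε01 : ∀ t ω, ε t ω = 0 ∨ ε t ω = 1)
    (hεmeas : ∀ t ∈ Finset.Icc 1 n, Measurable[F (t - 1)] (ε t))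
    (hZmeas : ∀ t ∈ Finset.Icc 1 n, Measurable[F t] (Z t))
    (hZcond : ∀ t ∈ Finset.Icc 1 n, P[Z t|F (t - 1)] =ᵐ[P] 0)
    (hZbdd : ∀ t ∈ Finset.Icc 1 n, ∀ᵐ ω ∂P, Z t ω ∈ Set.Icc a (a + c)) :
    let M : Ω → ℝ := fun ω ↦ Real.exp (∑ t ∈ Finset.Icc 1 n,
      ε t ω * (s * Z t ω - c ^ 2 * s ^ 2 / 8))
    Measurable[F n] M ∧ Integrable M P ∧ ∫ ω, M ω ∂P ≤ 1 := by
  set v := c ^ 2 * s ^ 2 / 8 with hv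
  induction n with
  | zero => simp [measurable_const]
  | succ n ih =>
    have hsub : Finset.Icc 1 n ⊆ Finset.Icc 1 (n + 1) :=
      Finset.Icc_subset_Icc_right n.le_succ
    obtain ⟨hMm, hMi, hM1⟩ := ih (fun t ht ↦ hεmeas t (hsub ht)) (fun t ht ↦ hZmeas t (hsub ht))
      (fun t ht ↦ hZcond t (hsub ht)) (fun t ht ↦ hZbdd t (hsub ht))
    set M : Ω → ℝ := fun ω ↦ Real.exp (∑ t ∈ Finset.Icc 1 n, ε t ω * (s * Z t ω - v))
    have hmem : n + 1 ∈ Finset.Icc 1 (n + 1) := by simp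
    have hε : Measurable[F n] (ε (n + 1)) := by simpa using hεmeas _ hmem
    have hZ : Measurable[F (n + 1)] (Z (n + 1)) := hZmeas _ hmem
    have hcond : P[Z (n + 1)|F n] =ᵐ[P] 0 := by simpa using hZcond _ hmem
    have hbdd := hZbdd _ hmem
    have hZΩ : Measurable (Z (n + 1)) := hZ.mono (F.le _) le_rfl
    have hεΩ : Measurable (ε (n + 1)) := hε.mono (F.le _) le_rfl
    have hεle (ω : Ω) : ‖ε (n + 1) ω‖ ≤ 1 := by
      rcases hε01 (n + 1) ω with h | h <;> simp [h]
    have hMεi : Integrable (fun ω ↦ M ω * ε (n + 1) ω) P :=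
      hMi.mul_bdd (c := 1) hεΩ.aestronglyMeasurable (.of_forall hεle)
    have hexpi : Integrable (fun ω ↦ M ω * ε (n + 1) ω * Real.exp (s * Z (n + 1) ω)) P := by
      refine hMεi.mul_bdd (c := Real.exp (|s| * max |a| |a + c|))
        (hZΩ.const_mul s).exp.aestronglyMeasurable ?_
      filter_upwards [hbdd] with ω h
      rw [Real.norm_eq_abs, Real.abs_exp]
      refine Real.exp_le_exp.2 ?_
      calc s * Z (n + 1) ω ≤ |s * Z (n + 1) ω| := le_abs_self _
        _ ≤ |s| * max |a| |a + c| := by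
          rw [abs_mul]
          gcongr
          exact abs_le_max_abs_abs h.1 h.2
    have hstep : (fun ω ↦ Real.exp (∑ t ∈ Finset.Icc 1 (n + 1), ε t ω * (s * Z t ω - v))) =
        fun ω ↦ M ω - M ω * ε (n + 1) ω +
          Real.exp (-v) * (M ω * ε (n + 1) ω * Real.exp (s * Z (n + 1) ω)) := by
      funext ω
      rw [Finset.sum_Icc_succ_top (by omega), Real.exp_add]
      change M ω * _ = _
      rcases hε01 (n + 1) ω with h | h
      · simp [h]
      · rw [h, one_mul, sub_eq_add_neg, Real.exp_add]
        ring
    have hle := F.mono n.le_succ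
    have hMm' : Measurable[F (n + 1)] M := hMm.mono hle le_rfl
    have hε' : Measurable[F (n + 1)] (ε (n + 1)) := hε.mono hle le_rfl
    have hHoeffding := integral_mul_exp_le_of_condExp_eq_zero (F.le n) (s := s) hc
      (W := fun ω ↦ M ω * ε (n + 1) ω) (hMm.mul hε).stronglyMeasurable
      (fun ω ↦ mul_nonneg (Real.exp_nonneg _) (by rcases hε01 (n + 1) ω with h | h <;> simp [h]))
      hMεi hZΩ.aemeasurable hcond hbdd
    dsimp only
    rw [hstep]
    refine ⟨?_, (hMi.sub hMεi).add (hexpi.const_mul _), ?_⟩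
    · exact (hMm'.sub (hMm'.mul hε')).add (((hMm'.mul hε').mul (hZ.const_mul s).exp).const_mul _)
    · rw [integral_add (by exact hMi.sub hMεi) (hexpi.const_mul _), integral_sub hMi hMεi,
        integral_const_mul]
      have h := mul_le_mul_of_nonneg_left hHoeffding (Real.exp_nonneg (-v))
      rw [← mul_assoc, ← Real.exp_add, ← hv, neg_add_cancel, Real.exp_zero, one_mul] at h
      linarith

/-- Hoeffding–Azuma inequality for optionally skipped martingale differences
(Lemma A.1 / Lemma "concentration" of Pike-Burke et al.): if `ε_t ∈ {0,1}` is
`F_{t−1}`-measurable, `Z_t` is `F_t`-measurable with `E[Z_t | F_{t−1}] = 0` and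
`Z_t ∈ [a, a+c]` a.s., and `Σ_{s=1}^n ε_s ≤ m` a.s., then for any `λ > 0`,
`P(Σ_{t=1}^n ε_t Z_t ≥ λ) ≤ exp(−2λ²/(c²m))`. -/
theorem optional_skipping_hoeffding
    {Ω : Type} [mΩ : MeasurableSpace Ω] (P : Measure Ω) [IsProbabilityMeasure P]
    (m n : ℕ) (hm : 0 < m) (hn : 0 < n) (a c : ℝ)
    (F : MeasureTheory.Filtration ℕ mΩ)
    (ε : ℕ → Ω → ℝ) (Z : ℕ → Ω → ℝ)
    (hε01 : ∀ t ω, ε t ω = 0 ∨ ε t ω = 1)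
    (hεmeas : ∀ t ∈ Finset.Icc 1 n, Measurable[F (t - 1)] (ε t))
    (hZmeas : ∀ t ∈ Finset.Icc 1 n, Measurable[F t] (Z t))
    (hZcond : ∀ t ∈ Finset.Icc 1 n, P[Z t|F (t - 1)] =ᵐ[P] 0)
    (hZbdd : ∀ t ∈ Finset.Icc 1 n, ∀ᵐ ω ∂P, Z t ω ∈ Set.Icc a (a + c))
    (hsum : ∀ᵐ ω ∂P, ∑ t ∈ Finset.Icc 1 n, ε t ω ≤ (m : ℝ))
    (lam : ℝ) (hlam : 0 < lam) :
    (P {ω | lam ≤ ∑ t ∈ Finset.Icc 1 n, ε t ω * Z t ω}).toReal ≤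
      Real.exp (-(2 * lam ^ 2) / (c ^ 2 * m)) := by
  have hc : 0 ≤ c := by
    obtain ⟨ω, hω⟩ := (hZbdd 1 (Finset.mem_Icc.2 ⟨le_rfl, hn⟩)).exists
    linarith [hω.1, hω.2]
  rcases hc.eq_or_lt with rfl | hcpos
  · simp only [ne_eq, OfNat.ofNat_ne_zero, not_false_eq_true, zero_pow, zero_mul, div_zero,
      Real.exp_zero]
    exact measureReal_le_one
  have hm' : (0 : ℝ) < m := by exact_mod_cast hm
  set s := 4 * lam / (c ^ 2 * m) with hs
  have hs0 : 0 ≤ s := by positivity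
  obtain ⟨-, hMi, hM1⟩ := integral_exp_sum_skipped_le_one n hc s F ε Z hε01 hεmeas hZmeas hZcond
    hZbdd
  set M : Ω → ℝ := fun ω ↦ Real.exp (∑ t ∈ Finset.Icc 1 n,
    ε t ω * (s * Z t ω - c ^ 2 * s ^ 2 / 8)) with hM
  set δ := Real.exp (2 * lam ^ 2 / (c ^ 2 * m)) with hδ
  have hexponent : s * lam - c ^ 2 * s ^ 2 / 8 * m = 2 * lam ^ 2 / (c ^ 2 * m) := by
    rw [hs]
    field_simp
    ring
  have hsubset : {ω | lam ≤ ∑ t ∈ Finset.Icc 1 n, ε t ω * Z t ω} ≤ᵐ[P] {ω | δ ≤ M ω} := by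
    filter_upwards [hsum] with ω hω hlamω
    change lam ≤ ∑ t ∈ Finset.Icc 1 n, ε t ω * Z t ω at hlamω
    change δ ≤ M ω
    have hsplit : ∑ t ∈ Finset.Icc 1 n, ε t ω * (s * Z t ω - c ^ 2 * s ^ 2 / 8) =
        s * ∑ t ∈ Finset.Icc 1 n, ε t ω * Z t ω -
          c ^ 2 * s ^ 2 / 8 * ∑ t ∈ Finset.Icc 1 n, ε t ω := by
      rw [Finset.mul_sum, Finset.mul_sum, ← Finset.sum_sub_distrib]
      exact Finset.sum_congr rfl fun t _ ↦ by ring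
    simp only [hδ, hM, hsplit, ← hexponent]
    gcongr
  have hmarkov : δ * P.real {ω | δ ≤ M ω} ≤ 1 :=
    (mul_meas_ge_le_integral_of_nonneg (.of_forall fun ω ↦ Real.exp_nonneg _) hMi δ).trans hM1
  calc P.real {ω | lam ≤ ∑ t ∈ Finset.Icc 1 n, ε t ω * Z t ω}
      ≤ P.real {ω | δ ≤ M ω} := ENNReal.toReal_mono (measure_ne_top _ _) (measure_mono_ae hsubset)
    _ ≤ Real.exp (-(2 * lam ^ 2) / (c ^ 2 * m)) := by
      rw [neg_div, Real.exp_neg, ← hδ, ← one_div, le_div_iff₀' (Real.exp_pos _)]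
      exact hmarkov
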